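/- arXiv:math/0212317 — 5 statements merged into one kernel-verified Lean document; each statement's English description precedes it below -/
import Mathlib

section
/- Let H be a bialgebra over a commutative ring R with comultiplication Δ, let N be a natural number, and let L, L̄ be N × N matrices with entries in H satisfying, for all indices a, b: Δ(L_{a,b}) = Σ_c L_{c,b} ⊗ L_{a,c} and Δ(L̄_{a,b}) = Σ_c L̄_{a,c} ⊗ L̄_{c,b}. Let K be an N × N matrix with entries in R, regarded in H via the algebra map R → H. Define the N × N matrix B over H by B := L̄ * K * L (matrix product). Then for all a, b: Δ(B_{a,b}) = Σ_{c,d} (L̄_{a,c} * L_{d,b}) ⊗ B_{c,d}. -/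
open TensorProduct

/-- Let `H` be a bialgebra over a commutative ring `R`, and `L`, `L̄`
be `N × N` matrices over `H` with `Δ(L_{a,b}) = Σ_c L_{c,b} ⊗ L_{a,c}` and
`Δ(L̄_{a,b}) = Σ_c L̄_{a,c} ⊗ L̄_{c,b}`. Let `K` be an `N × N` matrix over `R`,
viewed in `H` via `algebraMap`, and `B = L̄ * K * L`. Then
`Δ(B_{a,b}) = Σ_{c,d} (L̄_{a,c} * L_{d,b}) ⊗ B_{c,d}`. -/
theorem boundary_generators_coproduct {R H : Type*} [CommRing R] [Ring H]
    [Bialgebra R H] (N : ℕ) (L Lbar : Matrix (Fin N) (Fin N) H)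
    (K : Matrix (Fin N) (Fin N) R)
    (hL : ∀ a b, Coalgebra.comul (R := R) (L a b) = ∑ c, L c b ⊗ₜ[R] L a c)
    (hLbar : ∀ a b, Coalgebra.comul (R := R) (Lbar a b) = ∑ c, Lbar a c ⊗ₜ[R] Lbar c b)
    (B : Matrix (Fin N) (Fin N) H)
    (hB : B = Lbar * K.map (algebraMap R H) * L) :
    ∀ a b, Coalgebra.comul (R := R) (B a b) =
      ∑ c, ∑ d, (Lbar a c * L d b) ⊗ₜ[R] B c d := by
  intro a b
  have comul_term (x y : Fin N) :
      Coalgebra.comul (R := R) (Lbar a y * algebraMap R H (K y x) * L x b) =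
        ∑ c, ∑ d, (Lbar a c * L d b) ⊗ₜ[R] (Lbar c y * algebraMap R H (K y x) * L x d) := by
    rw [Bialgebra.comul_mul, Bialgebra.comul_mul, Bialgebra.comul_algebraMap, hL, hLbar,
      Algebra.TensorProduct.algebraMap_apply']
    simp only [Finset.sum_mul, Finset.mul_sum, Algebra.TensorProduct.tmul_mul_tmul, mul_one]
    exact Finset.sum_comm
  subst hB
  simp only [Matrix.mul_apply, Matrix.map_apply, Finset.sum_mul, map_sum, comul_term,
    TensorProduct.tmul_sum]
  rw [Finset.sum_comm_cycle]
  exact Finset.sum_congr rfl fun c _ => Finset.sum_comm_cycle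
end

section
/- Let H be a bialgebra over a commutative ring R with comultiplication Δ, let N be a natural number, and let L, L̄ be N × N matrices with entries in H satisfying, for all indices a, b: Δ(L_{a,b}) = Σ_c L_{c,b} ⊗ L_{a,c} and Δ(L̄_{a,b}) = Σ_c L̄_{a,c} ⊗ L̄_{c,b}. Let K be an N × N matrix with entries in R, regarded in H via the algebra map R → H, and set B := L̄ * K * L. Let 𝓑 be the R-subalgebra of H generated by the entries {B_{c,d}}. Then 𝓑 is a left coideal subalgebra of H: for every x ∈ 𝓑, Δ(x) lies in the image of the canonical map H ⊗ 𝓑 → H ⊗ H. -/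
open TensorProduct

/-- The comultiplication of an entry of `L̄ * K * L`. -/
theorem comul_mul_map_algebraMap_mul_apply {R H n : Type*} [CommRing R] [Ring H]
    [Bialgebra R H] [Fintype n] {L Lbar : Matrix n n H} (K : Matrix n n R)
    (hL : ∀ a b, Coalgebra.comul (R := R) (L a b) = ∑ c, L c b ⊗ₜ[R] L a c)
    (hLbar : ∀ a b, Coalgebra.comul (R := R) (Lbar a b) = ∑ c, Lbar a c ⊗ₜ[R] Lbar c b)
    (a b : n) :
    Coalgebra.comul (R := R) ((Lbar * K.map (algebraMap R H) * L) a b) =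
      ∑ c, ∑ d, (Lbar a c * L d b) ⊗ₜ[R] (Lbar * K.map (algebraMap R H) * L) c d := by
  have entry (a b : n) : (Lbar * K.map (algebraMap R H) * L) a b =
      ∑ j, ∑ i, K i j • (Lbar a i * L j b) := by
    simp only [Matrix.mul_apply, Matrix.map_apply, Finset.sum_mul, ← Algebra.commutes,
      Algebra.smul_def, mul_assoc]
  simp only [entry, map_sum, map_smul, Bialgebra.comul_mul, hL, hLbar, Finset.sum_mul_sum,
    Algebra.TensorProduct.tmul_mul_tmul, tmul_sum, tmul_smul, Finset.smul_sum]
  simp only [← Fintype.sum_prod_type']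
  refine Fintype.sum_equiv
    ((Equiv.prodAssoc n n (n × n)).symm.trans ((Equiv.prodComm _ _).trans (Equiv.prodAssoc _ _ _)))
    _ _ fun ⟨j, i, c, d⟩ => ?_
  simp

/-- With `L`, `L̄`, `K`, `B = L̄ * K * L` as in Statement 5, the
`R`-subalgebra `𝓑` of `H` generated by the entries of `B` is a left coideal
subalgebra of `H`: `Δ(x) ∈ image (H ⊗ 𝓑 → H ⊗ H)` for all `x ∈ 𝓑`. -/
theorem boundary_generators_coideal {R H : Type*} [CommRing R] [Ring H]
    [Bialgebra R H] (N : ℕ) (L Lbar : Matrix (Fin N) (Fin N) H)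
    (K : Matrix (Fin N) (Fin N) R)
    (hL : ∀ a b, Coalgebra.comul (R := R) (L a b) = ∑ c, L c b ⊗ₜ[R] L a c)
    (hLbar : ∀ a b, Coalgebra.comul (R := R) (Lbar a b) = ∑ c, Lbar a c ⊗ₜ[R] Lbar c b)
    (B : Matrix (Fin N) (Fin N) H)
    (hB : B = Lbar * K.map (algebraMap R H) * L)
    (𝓑 : Subalgebra R H)
    (h𝓑 : 𝓑 = Algebra.adjoin R {x : H | ∃ c d, x = B c d}) :
    ∀ x ∈ 𝓑, Coalgebra.comul (R := R) x ∈
      LinearMap.range (TensorProduct.map (LinearMap.id : H →ₗ[R] H)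
        (𝓑.val.toLinearMap : 𝓑 →ₗ[R] H)) := by
  intro x hx
  have hle : 𝓑 ≤ (Algebra.TensorProduct.map (AlgHom.id R H) 𝓑.val).range.comap
      (Bialgebra.comulAlgHom R H) := by
    conv_lhs => rw [h𝓑]
    refine Algebra.adjoin_le ?_
    rintro _ ⟨a, b, rfl⟩
    have hmem (c d : Fin N) : B c d ∈ 𝓑 := h𝓑 ▸ Algebra.subset_adjoin ⟨c, d, rfl⟩
    have hcomul : Coalgebra.comul (R := R) (B a b) =
        ∑ c, ∑ d, (Lbar a c * L d b) ⊗ₜ[R] B c d :=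
      hB ▸ comul_mul_map_algebraMap_mul_apply K hL hLbar a b
    rw [SetLike.mem_coe, Subalgebra.mem_comap, Bialgebra.comulAlgHom_apply, hcomul]
    exact Subalgebra.sum_mem _ fun c _ => Subalgebra.sum_mem _ fun d _ =>
      ⟨(Lbar a c * L d b) ⊗ₜ ⟨B c d, hmem c d⟩, rfl⟩
  exact hle hx
end

section
/- Let F be a field, n ≥ 1 a natural number, q, x ∈ F nonzero with q² ≠ 1, and z ∈ F with z² = −q·x (so z ≠ 0). Let ε : Fin(n+1) → F satisfy ε_i² = 1 for all i, and set ε̂ := ∏_{l=0}^{n} ε_l. Define the (n+1) × (n+1) matrix K over F by: K_{i,i} = (q⁻¹·z^{n+1} − ε̂·q·z^{−(n+1)}) / (q⁻¹ − q) for all i; K_{i,j} = (∏_{l=i}^{j−1} ε_l) · z^{n+1−2(j−i)} whenever i < j (as integers in {0,…,n}); and K_{j,i} = (∏_{l=i}^{j−1} ε_l) · ε̂ · z^{2(j−i)−(n+1)} whenever i < j. Then K is a solution of the boundary intertwining system: for every i ∈ Fin(n+1), writing i+1 for the cyclic successor of i modulo n+1, one has (a) ε_i·(q⁻¹ − q)·K_{i,i}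 + x·K_{i,i+1} − x⁻¹·K_{i+1,i} = 0; (b) K_{i+1,i+1} = K_{i,i}; and for every j ∈ Fin(n+1) with j ≠ i and j ≠ i+1: (c) ε_i·q·K_{i,j} + x⁻¹·K_{i+1,j} = 0 and (d) ε_i·q⁻¹·K_{j,i} + x·K_{j,i+1} = 0. -/
/-- `K` is a solution of the boundary intertwining system for parameters
`q`, `x`, `ε`: for all `i` (with `i+1` the cyclic successor mod `n+1`) and all
`j ≠ i, i+1`:
(a) `ε_i (q⁻¹ − q) K_{i,i} + x K_{i,i+1} − x⁻¹ K_{i+1,i} = 0`;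
(b) `K_{i+1,i+1} = K_{i,i}`;
(c) `ε_i q K_{i,j} + x⁻¹ K_{i+1,j} = 0`;
(d) `ε_i q⁻¹ K_{j,i} + x K_{j,i+1} = 0`. -/
def IsBISolution {F : Type*} [Field F] {n : ℕ} (q x : F) (ε : Fin (n + 1) → F)
    (K : Matrix (Fin (n + 1)) (Fin (n + 1)) F) : Prop :=
  ∀ i : Fin (n + 1),
    (ε i * (q⁻¹ - q) * K i i + x * K i (i + 1) - x⁻¹ * K (i + 1) i = 0) ∧
    (K (i + 1) (i + 1) = K i i) ∧
    (∀ j : Fin (n + 1), j ≠ i → j ≠ i + 1 →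
      (ε i * q * K i j + x⁻¹ * K (i + 1) j = 0) ∧
      (ε i * q⁻¹ * K j i + x * K j (i + 1) = 0))

/-- If `K` is, off the diagonal, the rank-one matrix `T i * U j` scaled by `A` above the diagonal
and by `e * A⁻¹` below it, with constant diagonal, and `T`, `U` satisfy twisted geometric
recursions, then `K` solves the boundary intertwining system. -/
theorem isBISolution_of_factorization {F : Type*} [Field F] {n : ℕ} (hn : 1 ≤ n)
    {q x A e d : F} (hq : q ≠ 0) (hx : x ≠ 0) (hA : A ≠ 0) (he : e ^ 2 = 1)
    {ε T U : Fin (n + 1) → F} {K : Matrix (Fin (n + 1)) (Fin (n + 1)) F}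
    (hd : (q⁻¹ - q) * d = q⁻¹ * A - e * q * A⁻¹) (hdiag : ∀ i, K i i = d)
    (hupper : ∀ i j, i < j → K i j = A * (T i * U j))
    (hlower : ∀ i j, i < j → K j i = e * A⁻¹ * (T j * U i))
    (hTU : ∀ i, T i * U i = 1)
    (hT : ∀ i : Fin (n + 1), i ≠ Fin.last n → T (i + 1) = ε i * (-q * x) * T i)
    (hU : ∀ i : Fin (n + 1), i ≠ Fin.last n → U (i + 1) = ε i * (-q * x)⁻¹ * U i)
    (hT0 : T 0 = 1) (hU0 : U 0 = 1)
    (hTlast : ε (Fin.last n) * T (Fin.last n) = e * A ^ 2 * (-q * x)⁻¹)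
    (hUlast : ε (Fin.last n) * U (Fin.last n) = e * (A ^ 2)⁻¹ * (-q * x))
    (hε : ∀ i, ε i ^ 2 = 1) :
    IsBISolution q x ε K := by
  have eT (c : F) : c * (-q * x)⁻¹ * x = -c * q⁻¹ := by field_simp
  have eU (c : F) : c * (-q * x) * x⁻¹ = -c * q := by field_simp
  intro i
  refine ⟨?_, by rw [hdiag, hdiag], ?_⟩
  · rw [hdiag]
    by_cases hi : i = Fin.last n
    · subst hi
      have h0 : (0 : Fin (n + 1)) < Fin.last n := by
        rw [Fin.lt_def]; simp; omega
      rw [Fin.last_add_one, hlower _ _ h0, hupper _ _ h0, hU0, hT0]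
      have h1 : T (Fin.last n) = ε (Fin.last n) * (e * A ^ 2 * (-q * x)⁻¹) := by
        linear_combination ε (Fin.last n) * hTlast - T (Fin.last n) * hε (Fin.last n)
      have h2 : U (Fin.last n) = ε (Fin.last n) * (e * (A ^ 2)⁻¹ * (-q * x)) := by
        linear_combination ε (Fin.last n) * hUlast - U (Fin.last n) * hε (Fin.last n)
      have h3 : x * (e * A⁻¹ * (T (Fin.last n) * 1)) = -(ε (Fin.last n) * q⁻¹ * A) := by
        rw [h1]; field_simp; linear_combination -ε (Fin.last n) * he
      have h4 : x⁻¹ * (A * (1 * U (Fin.last n))) = -(ε (Fin.last n) * e * q * A⁻¹) := by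
        rw [h2]; field_simp
      linear_combination ε (Fin.last n) * hd + h3 - h4
    · have hlt : i < i + 1 := Fin.lt_add_one_iff.2 (Fin.lt_last_iff_ne_last.2 hi)
      rw [hupper _ _ hlt, hlower _ _ hlt, hT i hi, hU i hi]
      linear_combination ε i * hd + A * ε i * T i * U i * eT 1 - e * A⁻¹ * ε i * T i * U i * eU 1
        + (-A * ε i * q⁻¹ + e * A⁻¹ * ε i * q) * hTU i
  · intro j hji hji'
    by_cases hi : i = Fin.last n
    · subst hi
      rw [Fin.last_add_one] at hji' ⊢
      have h0 : 0 < j := Fin.pos_iff_ne_zero.2 hji'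
      have hl : j < Fin.last n := Fin.lt_last_iff_ne_last.2 hji
      rw [hupper _ _ h0, hlower _ _ h0, hupper _ _ hl, hlower _ _ hl, hT0, hU0]
      constructor
      · have h : ε (Fin.last n) * q * (e * A⁻¹ * (T (Fin.last n) * U j))
            = e ^ 2 * (q * A⁻¹ * A ^ 2 * (-q * x)⁻¹) * U j := by
          linear_combination q * e * A⁻¹ * U j * hTlast
        rw [h, he]; field_simp; ring
      · have h : ε (Fin.last n) * q⁻¹ * (A * (T j * U (Fin.last n)))
            = e * (q⁻¹ * A * (A ^ 2)⁻¹ * (-q * x)) * T j := by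
          linear_combination q⁻¹ * A * T j * hUlast
        rw [h]; field_simp; ring
    · have hlt : i < i + 1 := Fin.lt_add_one_iff.2 (Fin.lt_last_iff_ne_last.2 hi)
      rcases lt_or_gt_of_ne hji with h | h
      · have h' := h.trans hlt
        rw [hlower _ _ h, hlower _ _ h', hupper _ _ h, hupper _ _ h', hT i hi, hU i hi]
        constructor
        · linear_combination e * A⁻¹ * ε i * T i * U j * eU 1
        · linear_combination A * ε i * U i * T j * eT 1
      · have h' : i + 1 < j := lt_of_le_of_ne (Fin.add_one_le_of_lt h) hji'.symm
        rw [hlower _ _ h, hlower _ _ h', hupper _ _ h, hupper _ _ h', hT i hi, hU i hi]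
        constructor
        · linear_combination A * ε i * T i * U j * eU 1
        · linear_combination e * A⁻¹ * ε i * U i * T j * eT 1

/-- For `n ≥ 1`, nonzero `q, x` with `q² ≠ 1`, `z` with `z² = −q·x`,
and `ε` with `ε_i² = 1` for all `i`, the matrix `K` with
`K_{i,i} = (q⁻¹ z^{n+1} − ε̂ q z^{−(n+1)})/(q⁻¹ − q)`,
`K_{i,j} = (∏_{l=i}^{j−1} ε_l) z^{n+1−2(j−i)}` for `i < j`, and
`K_{j,i} = (∏_{l=i}^{j−1} ε_l) ε̂ z^{2(j−i)−(n+1)}` for `i < j`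
(where `ε̂ = ∏_l ε_l`) is a solution of the boundary intertwining system. -/
theorem vector_reflection_matrix_solves_system {F : Type*} [Field F] {n : ℕ}
    (hn : 1 ≤ n) (q x z : F) (hq : q ≠ 0) (hx : x ≠ 0) (hq2 : q ^ 2 ≠ 1)
    (hz : z ^ 2 = -q * x) (ε : Fin (n + 1) → F) (hε : ∀ i, ε i ^ 2 = 1)
    (εhat : F) (hεhat : εhat = ∏ l, ε l)
    (K : Matrix (Fin (n + 1)) (Fin (n + 1)) F)
    (hKdiag : ∀ i : Fin (n + 1),
      K i i = (q⁻¹ * z ^ ((n : ℤ) + 1) - εhat * q * z ^ (-((n : ℤ) + 1))) / (q⁻¹ - q))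
    (hKupper : ∀ i j : Fin (n + 1), i < j →
      K i j = (∏ l ∈ Finset.Ico i j, ε l) *
        z ^ ((n : ℤ) + 1 - 2 * ((j : ℤ) - (i : ℤ))))
    (hKlower : ∀ i j : Fin (n + 1), i < j →
      K j i = (∏ l ∈ Finset.Ico i j, ε l) * εhat *
        z ^ (2 * ((j : ℤ) - (i : ℤ)) - ((n : ℤ) + 1))) :
    IsBISolution q x ε K := by
  have hs : z ^ 2 ≠ 0 := by rw [hz]; exact mul_ne_zero (neg_ne_zero.2 hq) hx
  have hz0 : z ≠ 0 := fun h => hs (by simp [h])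
  have hqq : q⁻¹ - q ≠ 0 := by
    intro h
    apply hq2
    field_simp at h
    linear_combination -h
  have hN : (n : ℤ) + 1 = ((n + 1 : ℕ) : ℤ) := by push_cast; rfl
  have hsq (s : Finset (Fin (n + 1))) : (∏ l ∈ s, ε l) ^ 2 = 1 := by
    rw [← Finset.prod_pow]; exact Finset.prod_eq_one fun i _ => hε i
  set Q : Fin (n + 1) → F := fun i => ∏ l ∈ Finset.Iio i, ε l with hQ
  have hQsq (i) : Q i ^ 2 = 1 := hsq _
  have hQ0 : Q 0 = 1 := Finset.prod_eq_one fun l hl => by simp at hl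
  have hQIco {i j : Fin (n + 1)} (h : i < j) : ∏ l ∈ Finset.Ico i j, ε l = Q i * Q j := by
    have h1 : Q i * ∏ l ∈ Finset.Ico i j, ε l = Q j := by
      rw [hQ, ← Finset.prod_union]
      · congr 1
        ext l
        simp only [Finset.mem_union, Finset.mem_Iio, Finset.mem_Ico]
        grind
      · rw [Finset.disjoint_left]
        intro l
        simp only [Finset.mem_Iio, Finset.mem_Ico]
        grind
    linear_combination Q i * h1 - (∏ l ∈ Finset.Ico i j, ε l) * hQsq i
  have hQIic (i : Fin (n + 1)) : ∏ l ∈ Finset.Iic i, ε l = ε i * Q i := by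
    rw [← Finset.Iio_insert, Finset.prod_insert (by simp)]
  have hval {i : Fin (n + 1)} (hi : i ≠ Fin.last n) : (i + 1).val = i.val + 1 :=
    Fin.val_add_one_of_lt (Fin.lt_last_iff_ne_last.2 hi)
  have hQsucc (i : Fin (n + 1)) (hi : i ≠ Fin.last n) : Q (i + 1) = ε i * Q i := by
    rw [← hQIic]
    refine Finset.prod_congr ?_ fun _ _ => rfl
    ext l
    simp only [Finset.mem_Iio, Finset.mem_Iic, Fin.lt_def, Fin.le_def, hval hi]
    omega
  have hQlast : ε (Fin.last n) * Q (Fin.last n) = εhat := by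
    rw [← hQIic, hεhat]
    refine Finset.prod_congr ?_ fun _ _ => rfl
    ext l
    simp [Fin.le_last]
  refine isBISolution_of_factorization hn (A := z ^ (n + 1)) (e := εhat)
    (T := fun i => Q i * (z ^ 2) ^ i.val) (U := fun i => Q i * ((z ^ 2) ^ i.val)⁻¹)
    hq hx (pow_ne_zero _ hz0) (hεhat ▸ hsq _) ?_ hKdiag ?_ ?_ ?_ ?_ ?_ ?_ ?_ ?_ ?_ hε
  · rw [mul_div_cancel₀ _ hqq, zpow_neg, hN, zpow_natCast]
  · intro i j hij
    rw [hKupper i j hij, hQIco hij, mul_sub, zpow_sub₀ hz0, zpow_sub₀ hz0, zpow_mul, zpow_mul,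
      hN, zpow_natCast, zpow_natCast, zpow_natCast, zpow_ofNat]
    field_simp
  · intro i j hij
    rw [hKlower i j hij, hQIco hij, mul_sub, zpow_sub₀ hz0, zpow_sub₀ hz0, zpow_mul, zpow_mul,
      hN, zpow_natCast, zpow_natCast, zpow_natCast, zpow_ofNat]
    field_simp
  · intro i
    have := pow_ne_zero i.val hs
    rw [mul_mul_mul_comm, mul_inv_cancel₀ this, mul_one, ← sq, hQsq]
  · intro i hi
    simp only [hQsucc i hi, hval hi, ← hz]
    ring
  · intro i hi
    simp only [hQsucc i hi, hval hi, ← hz, pow_succ _ i.val, mul_inv]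
    ring
  · simp [hQ0]
  · simp [hQ0]
  · simp only [Fin.val_last, ← hz, ← mul_assoc, hQlast]
    field_simp
    ring
  · simp only [Fin.val_last, ← hz, ← mul_assoc, hQlast]
    field_simp
    ring
end

section
/- Let F be a field, n ≥ 2 a natural number, and q, x ∈ F nonzero with q² ≠ 1. Let ε : Fin(n+1) → F satisfy ε_i ≠ 0 for all i. Then the set of (n+1) × (n+1) matrices K over F that are solutions of the boundary intertwining system is an F-subspace of dimension at most 1; equivalently, if K and K' are both solutions and K' ≠ 0, then there exists c ∈ F with K = c • K'. -/
namespace IsBISolution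

variable {F : Type*} [Field F] {n : ℕ} {q x : F} {ε : Fin (n + 1) → F}
  {K K' : Matrix (Fin (n + 1)) (Fin (n + 1)) F}

theorem sub_smul (hK : IsBISolution q x ε K) (hK' : IsBISolution q x ε K') (c : F) :
    IsBISolution q x ε (K - c • K') := by
  intro i
  obtain ⟨ha, hb, hcd⟩ := hK i
  obtain ⟨ha', hb', hcd'⟩ := hK' i
  simp only [Matrix.sub_apply, Matrix.smul_apply, smul_eq_mul]
  refine ⟨by linear_combination ha - c * ha', by linear_combination hb - c * hb', ?_⟩
  intro j hj hj'
  obtain ⟨hc, hd⟩ := hcd j hj hj'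
  obtain ⟨hc', hd'⟩ := hcd' j hj hj'
  exact ⟨by linear_combination hc - c * hc', by linear_combination hd - c * hd'⟩

/-- A zero off-diagonal entry propagates down its column, away from the diagonal. -/
theorem row_succ_eq_zero (hK : IsBISolution q x ε K) (hx : x ≠ 0) {i j : Fin (n + 1)}
    (hj : j ≠ i) (hj' : j ≠ i + 1) (h : K i j = 0) : K (i + 1) j = 0 := by
  simpa [h, hx] using ((hK i).2.2 j hj hj').1

/-- A zero off-diagonal entry propagates along its row, away from the diagonal. -/
theorem col_succ_eq_zero (hK : IsBISolution q x ε K) (hx : x ≠ 0) {i j : Fin (n + 1)}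
    (hj : j ≠ i) (hj' : j ≠ i + 1) (h : K j i = 0) : K j (i + 1) = 0 := by
  simpa [h, hx] using ((hK i).2.2 j hj hj').2

open Fin.CommRing in
theorem subdiagonal_eq_zero (hK : IsBISolution q x ε K) (hn : 2 ≤ n) (hx : x ≠ 0)
    (h : K 1 0 = 0) (i : Fin (n + 1)) : K (i + 1) i = 0 := by
  have h1 : (1 : Fin (n + 1)) ≠ 0 := by
    rw [Ne, Fin.ext_iff, Fin.val_one', Fin.val_zero, Nat.mod_eq_of_lt (by lia)]
    lia
  have h2 : (1 + 1 : Fin (n + 1)) ≠ 0 := by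
    rw [Ne, Fin.ext_iff, Fin.val_add, Fin.val_one', Fin.val_zero,
      Nat.mod_eq_of_lt (a := 1) (by lia), Nat.mod_eq_of_lt (by lia)]
    lia
  have key : ∀ m : ℕ, K ((m : Fin (n + 1)) + 1) (m : Fin (n + 1)) = 0 := by
    intro m
    induction m with
    | zero => simpa using h
    | succ m ih =>
      have hm : (m : Fin (n + 1)) + 1 ≠ m := by simpa using h1
      have hm' : (m : Fin (n + 1)) + 1 + 1 ≠ m := by
        rw [add_assoc]
        simpa using h2
      have hm'' : (m : Fin (n + 1)) + 1 + 1 ≠ m + 1 := by simpa using h1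
      rw [Nat.cast_succ]
      exact hK.col_succ_eq_zero hx hm' hm'' (hK.row_succ_eq_zero hx hm.symm hm'.symm ih)
  simpa using key i.val

open Fin.CommRing in
theorem offDiagonal_eq_zero (hK : IsBISolution q x ε K) (hn : 2 ≤ n) (hx : x ≠ 0)
    (h : K 1 0 = 0) {i j : Fin (n + 1)} (hij : i ≠ j) : K i j = 0 := by
  have key : ∀ m : ℕ, (m : Fin (n + 1)) ≠ 0 → K (j + m) j = 0 := by
    intro m
    induction m with
    | zero => intro h0; simp at h0
    | succ m ih =>
      intro hm
      rw [Nat.cast_succ] at hm ⊢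
      by_cases h0 : (m : Fin (n + 1)) = 0
      · simpa [h0] using hK.subdiagonal_eq_zero hn hx h j
      · rw [← add_assoc]
        refine hK.row_succ_eq_zero hx (by simpa using h0) ?_ (ih h0)
        rw [add_assoc]
        simpa using hm
  simpa using key (i - j).val (by simpa [sub_eq_zero] using hij)

theorem eq_zero (hK : IsBISolution q x ε K) (hn : 2 ≤ n) (hq : q ≠ 0) (hx : x ≠ 0)
    (hq2 : q ^ 2 ≠ 1) (hε : ∀ i, ε i ≠ 0) (h : K 1 0 = 0) : K = 0 := by
  have hqq : q⁻¹ - q ≠ 0 := by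
    intro h0
    apply hq2
    field_simp at h0
    linear_combination -h0
  ext i j
  rw [Matrix.zero_apply]
  by_cases hij : i = j
  · subst hij
    have hi : i ≠ i + 1 := by
      rw [Ne, left_eq_add, Fin.ext_iff, Fin.val_one', Fin.val_zero, Nat.mod_eq_of_lt (by lia)]
      lia
    simpa [hK.offDiagonal_eq_zero hn hx h hi, hK.offDiagonal_eq_zero hn hx h hi.symm,
      hε i, hqq] using (hK i).1
  · exact hK.offDiagonal_eq_zero hn hx h hij

end IsBISolution

/-- For `n ≥ 2`, nonzero `q, x` with `q² ≠ 1` and `ε_i ≠ 0` for all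
`i`, the space of solutions of the boundary intertwining system has dimension at
most 1: if `K` and `K'` are both solutions and `K' ≠ 0`, then `K = c • K'` for
some `c ∈ F`. -/
theorem reflection_matrix_unique_up_to_scalar {F : Type*} [Field F] {n : ℕ}
    (hn : 2 ≤ n) (q x : F) (hq : q ≠ 0) (hx : x ≠ 0) (hq2 : q ^ 2 ≠ 1)
    (ε : Fin (n + 1) → F) (hε : ∀ i, ε i ≠ 0)
    (K K' : Matrix (Fin (n + 1)) (Fin (n + 1)) F)
    (hK : IsBISolution q x ε K) (hK' : IsBISolution q x ε K') (hK'0 : K' ≠ 0) :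
    ∃ c : F, K = c • K' := by
  have h0 : K' 1 0 ≠ 0 := fun h => hK'0 (hK'.eq_zero hn hq hx hq2 hε h)
  refine ⟨K 1 0 / K' 1 0, sub_eq_zero.mp ?_⟩
  refine (hK.sub_smul hK' _).eq_zero hn hq hx hq2 hε ?_
  simp [h0]
end

section
/- Let F be a field, n ≥ 2 a natural number, and q, x ∈ F nonzero. Let ε : Fin(n+1) → F be identically zero. Then every (n+1) × (n+1) matrix K over F that is a solution of the boundary intertwining system is a scalar multiple of the identity matrix: K = K_{0,0} • 1. -/
namespace IsBISolution

variable {F : Type*} [Field F] {n : ℕ} {q x : F} {ε : Fin (n + 1) → F}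
  {K : Matrix (Fin (n + 1)) (Fin (n + 1)) F}

theorem diag_eq (hK : IsBISolution q x ε K) (i : Fin (n + 1)) : K i i = K 0 0 := by
  induction i using Fin.induction with
  | zero => rfl
  | succ i ih => rw [← Fin.coeSucc_eq_succ, (hK i.castSucc).2.1, ih]

theorem apply_eq_zero_of_add_one_ne (hK : IsBISolution q x ε K) (hx : x ≠ 0)
    (hε : ∀ i, ε i = 0) {a b : Fin (n + 1)} (hab : a ≠ b) (h : b + 1 ≠ a) : K a b = 0 := by
  have hc := ((hK (a - 1)).2.2 b (fun e => h (by rw [e, sub_add_cancel]))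
    (by rw [sub_add_cancel]; exact hab.symm)).1
  simpa [hε, hx] using hc

theorem apply_eq_zero_of_ne_add_one (hK : IsBISolution q x ε K) (hx : x ≠ 0)
    (hε : ∀ i, ε i = 0) {a b : Fin (n + 1)} (hab : a ≠ b) (h : a + 1 ≠ b) : K a b = 0 := by
  have hd := ((hK (b - 1)).2.2 a (fun e => h (by rw [e, sub_add_cancel]))
    (by rw [sub_add_cancel]; exact hab)).2
  simpa [hε, hx] using hd

theorem apply_eq_zero_of_ne (hK : IsBISolution q x ε K) (hn : 2 ≤ n) (hx : x ≠ 0)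
    (hε : ∀ i, ε i = 0) {a b : Fin (n + 1)} (hab : a ≠ b) : K a b = 0 := by
  by_cases h : b + 1 = a
  · refine hK.apply_eq_zero_of_ne_add_one hx hε hab fun h' => ?_
    rw [← h, add_assoc, add_eq_left] at h'
    obtain ⟨m, rfl⟩ := Nat.exists_eq_add_of_le' hn
    have h2 : 2 % (m + 2 + 1) = 0 := by simpa [Fin.ext_iff, Fin.val_add] using h'
    rw [Nat.mod_eq_of_lt (by omega)] at h2
    exact two_ne_zero h2
  · exact hK.apply_eq_zero_of_add_one_ne hx hε hab h

end IsBISolution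

/-- For `n ≥ 2`, nonzero `q, x`, and vanishing boundary parameters
`ε ≡ 0`, every solution of the boundary intertwining system is a scalar multiple
of the identity matrix: `K = K_{0,0} • 1`. -/
theorem reflection_matrix_diagonal_of_zero_parameters {F : Type*} [Field F] {n : ℕ}
    (hn : 2 ≤ n) (q x : F) (hq : q ≠ 0) (hx : x ≠ 0)
    (ε : Fin (n + 1) → F) (hε : ∀ i, ε i = 0)
    (K : Matrix (Fin (n + 1)) (Fin (n + 1)) F)
    (hK : IsBISolution q x ε K) :
    K = K 0 0 • (1 : Matrix (Fin (n + 1)) (Fin (n + 1)) F) := by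
  ext a b
  rcases eq_or_ne a b with rfl | hab
  · simpa using hK.diag_eq a
  · simpa [hab] using hK.apply_eq_zero_of_ne hn hx hε hab
end
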